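/- Assume a ground state u^a_gr of 𝓔ᵃ is strongly stable with constant c_a > 0. Then there exists ε_Γ > 0 such that for all F₀ ∈ ℝ with |F₀| < ε_Γ, the infinite corrector problem has a solution q_∞ ∈ 𝒬_∞ = 𝒰 (a critical point of 𝓔^Γ(·; F₀)) satisfying ⟨δ²𝓔^Γ(q_∞; F₀)v, v⟩ ≥ (c_a/2)‖v'‖²_{ℓ²} for all v ∈ 𝒰, and there exist C > 0 and 0 ≤ μ_q < 1 such that |(q_∞)'_ℓ| ≤ C μ_q^ℓ for all ℓ ∈ ℤ_{≥0}. -/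

import Mathlib

open scoped BigOperators ENNReal
open Filter MeasureTheory

noncomputable section

/-- discrete strain: `u'_ℓ = u_{ℓ+1} - u_ℓ` -/
def du (u : ℕ → ℝ) (ℓ : ℕ) : ℝ := u (ℓ + 1) - u ℓ

/-- second difference of strains: `u''_ℓ = u'_{ℓ+1} - u'_ℓ` -/
def ddu (u : ℕ → ℝ) (ℓ : ℕ) : ℝ := du u (ℓ + 1) - du u ℓ

/-- the displacement space 𝒰 -/
def memU (u : ℕ → ℝ) : Prop := u 0 = 0 ∧ Summable (fun ℓ => (du u ℓ) ^ 2)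

/-- ℓ² norm of a sequence -/
def l2 (e : ℕ → ℝ) : ℝ := Real.sqrt (∑' ℓ, (e ℓ) ^ 2)

/-- compactly supported lattice function -/
def FinSupp (u : ℕ → ℝ) : Prop := ∃ N : ℕ, ∀ ℓ : ℕ, N ≤ ℓ → u ℓ = 0

/-- membership in the dual space 𝒰* -/
def memUstar (f : ℕ → ℝ) : Prop :=
  ∃ M : ℝ, ∀ u : ℕ → ℝ, u 0 = 0 → FinSupp u → |∑' ℓ, f ℓ * u ℓ| ≤ M * l2 (du u)

/-- the dual norm ‖f‖_{𝒰*} -/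
def dualNorm (f : ℕ → ℝ) : ℝ :=
  sInf {M : ℝ | 0 ≤ M ∧ ∀ u : ℕ → ℝ, u 0 = 0 → FinSupp u →
    |∑' ℓ, f ℓ * u ℓ| ≤ M * l2 (du u)}

/-- `g_ℓ = Σ_{k=ℓ+1}^∞ f_k`, as a limit of partial sums -/
def gOf (f : ℕ → ℝ) (ℓ : ℕ) : ℝ :=
  limUnder atTop (fun K : ℕ => ∑ k ∈ Finset.Ico (ℓ + 1) K, f k)

/-- duality pairing `⟨f, v⟩` for `v ∈ 𝒰`, extended by continuity (summation by parts) -/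
def pairF (f : ℕ → ℝ) (v : ℕ → ℝ) : ℝ := ∑' ℓ, gOf f ℓ * du v ℓ

/-- partial derivatives of the bulk site potential -/
def d1V (V : ℝ → ℝ → ℝ) (r s : ℝ) : ℝ := deriv (fun t => V t s) r
def d2V (V : ℝ → ℝ → ℝ) (r s : ℝ) : ℝ := deriv (fun t => V r t) s
def d11V (V : ℝ → ℝ → ℝ) (r s : ℝ) : ℝ := deriv (fun t => d1V V t s) r
def d12V (V : ℝ → ℝ → ℝ) (r s : ℝ) : ℝ := deriv (fun t => d1V V r t) s
def d22V (V : ℝ → ℝ → ℝ) (r s : ℝ) : ℝ := deriv (fun t => d2V V r t) s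

/-- Cauchy–Born energy density `W(F) = V(F,F)` and its derivatives -/
def Wcb (V : ℝ → ℝ → ℝ) (F : ℝ) : ℝ := V F F
def dW (V : ℝ → ℝ → ℝ) (F : ℝ) : ℝ := deriv (Wcb V) F
def d2W (V : ℝ → ℝ → ℝ) (F : ℝ) : ℝ := deriv (dW V) F

/-- standing assumptions (i)–(vi) on the site energies -/
structure SiteAssumptions (V : ℝ → ℝ → ℝ) (Vs : ℝ → ℝ) : Prop where
  smooth_V : ContDiff ℝ 3 (Function.uncurry V)
  smooth_Vs : ContDiff ℝ 3 Vs
  bdd_V : ∀ i : ℕ, i ≤ 3 → ∃ B : ℝ, ∀ p : ℝ × ℝ,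
    ‖iteratedFDeriv ℝ i (Function.uncurry V) p‖ ≤ B
  bdd_Vs : ∀ i : ℕ, i ≤ 3 → ∃ B : ℝ, ∀ x : ℝ, ‖iteratedFDeriv ℝ i Vs x‖ ≤ B
  V_zero : V 0 0 = 0
  posdef : ∀ p : ℝ × ℝ, p ≠ 0 →
    0 < d11V V 0 0 * p.1 ^ 2 + 2 * d12V V 0 0 * p.1 * p.2 + d22V V 0 0 * p.2 ^ 2
  pos_away : ∀ ε : ℝ, 0 < ε → ∃ δ : ℝ, 0 < δ ∧
    ∀ r s : ℝ, ε < Real.sqrt (r ^ 2 + s ^ 2) → δ ≤ V r s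
  surf_limit : ∀ s : ℝ, Tendsto (fun r => V r s) atTop (nhds (Vs s))

/-- atomistic energy, with values in `[0,∞]` (the site energies are nonnegative
under the standing assumptions) -/
def EaE (V : ℝ → ℝ → ℝ) (Vs : ℝ → ℝ) (u : ℕ → ℝ) : ℝ≥0∞ :=
  ENNReal.ofReal (Vs (du u 0)) +
    ∑' ℓ : ℕ, ENNReal.ofReal (V (du u ℓ) (du u (ℓ + 1)))

/-- ground state: global minimizer of the atomistic energy over 𝒰 -/
def GroundState (V : ℝ → ℝ → ℝ) (Vs : ℝ → ℝ) (u : ℕ → ℝ) : Prop :=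
  memU u ∧ ∀ w : ℕ → ℝ, memU w → EaE V Vs u ≤ EaE V Vs w

/-- first variation of 𝓔ᵃ, as a function of the strain sequence `e` -/
def fvA (V : ℝ → ℝ → ℝ) (Vs : ℝ → ℝ) (e : ℕ → ℝ) (v : ℕ → ℝ) : ℝ :=
  du v 0 * (deriv Vs (e 0) + d1V V (e 0) (e 1)) +
    ∑' ℓ : ℕ, du v (ℓ + 1) *
      (d2V V (e ℓ) (e (ℓ + 1)) + d1V V (e (ℓ + 1)) (e (ℓ + 2)))

/-- second variation (of 𝓔ᵃ, and of 𝓔^Γ) as a function of the strain sequence `e` -/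
def svA (V : ℝ → ℝ → ℝ) (Vs : ℝ → ℝ) (e : ℕ → ℝ) (v : ℕ → ℝ) : ℝ :=
  deriv (deriv Vs) (e 0) * (du v 0) ^ 2 +
    ∑' ℓ : ℕ, (d11V V (e ℓ) (e (ℓ + 1)) * (du v ℓ) ^ 2
      + 2 * d12V V (e ℓ) (e (ℓ + 1)) * du v ℓ * du v (ℓ + 1)
      + d22V V (e ℓ) (e (ℓ + 1)) * (du v (ℓ + 1)) ^ 2)

/-- a strongly stable ground state with stability constant `c` -/
def StronglyStableGS (V : ℝ → ℝ → ℝ) (Vs : ℝ → ℝ) (u : ℕ → ℝ) (c : ℝ) : Prop :=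
  GroundState V Vs u ∧ 0 < c ∧
    ∀ v : ℕ → ℝ, memU v → c * ∑' ℓ, (du v ℓ) ^ 2 ≤ svA V Vs (du u) v

/-- critical point of 𝓔ᵃ: the pointwise Euler–Lagrange equations -/
def CriticalA (V : ℝ → ℝ → ℝ) (Vs : ℝ → ℝ) (u : ℕ → ℝ) : Prop :=
  deriv Vs (du u 0) + d1V V (du u 0) (du u 1) = 0 ∧
  ∀ ℓ : ℕ, d2V V (du u ℓ) (du u (ℓ + 1)) + d1V V (du u (ℓ + 1)) (du u (ℓ + 2)) = 0

/-- first variation of the corrector energy 𝓔^Γ(·;F₀) -/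
def fvG (V : ℝ → ℝ → ℝ) (Vs : ℝ → ℝ) (F0 : ℝ) (q v : ℕ → ℝ) : ℝ :=
  du v 0 * (deriv Vs (F0 + du q 0) + d1V V (F0 + du q 0) (F0 + du q 1) - dW V F0) +
    ∑' ℓ : ℕ, du v (ℓ + 1) *
      (d2V V (F0 + du q ℓ) (F0 + du q (ℓ + 1))
        + d1V V (F0 + du q (ℓ + 1)) (F0 + du q (ℓ + 2)) - dW V F0)

/-- critical point of the corrector energy: pointwise Euler–Lagrange equations -/
def CriticalG (V : ℝ → ℝ → ℝ) (Vs : ℝ → ℝ) (F0 : ℝ) (q : ℕ → ℝ) : Prop :=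
  deriv Vs (F0 + du q 0) + d1V V (F0 + du q 0) (F0 + du q 1) - dW V F0 = 0 ∧
  ∀ ℓ : ℕ, d2V V (F0 + du q ℓ) (F0 + du q (ℓ + 1))
      + d1V V (F0 + du q (ℓ + 1)) (F0 + du q (ℓ + 2)) - dW V F0 = 0

/-- second variation of the corrector energy at `q` -/
def svG (V : ℝ → ℝ → ℝ) (Vs : ℝ → ℝ) (F0 : ℝ) (q v : ℕ → ℝ) : ℝ :=
  svA V Vs (fun ℓ => F0 + du q ℓ) v

/-- membership in 𝒬_L -/
def memQL (L : ℕ) (q : ℕ → ℝ) : Prop := memU q ∧ ∀ ℓ : ℕ, L ≤ ℓ → du q ℓ = 0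

/-- continuous piecewise affine interpolant of a lattice function -/
def fAff (f : ℕ → ℝ) (x : ℝ) : ℝ :=
  f ⌊x⌋₊ + (x - (⌊x⌋₊ : ℝ)) * (f (⌊x⌋₊ + 1) - f ⌊x⌋₊)

/-- `g̃(x) = ∫_x^∞ f(s) ds`, improper integral of the interpolant -/
def gTilde (f : ℕ → ℝ) (x : ℝ) : ℝ :=
  limUnder atTop (fun K : ℕ => ∫ t in x..(K : ℝ), fAff f t)

/-- the Cauchy–Born continuum energy of a strain field `w = ∇u`, valued in `[0,∞]` -/
def EcbE (V : ℝ → ℝ → ℝ) (w : ℝ → ℝ) : ℝ≥0∞ :=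
  ∫⁻ x in Set.Ioi (0 : ℝ), ENNReal.ofReal (Wcb V (w x))

/-- strain of the projection `Π_a u^cb`, given the gradient `w = ∇u^cb` -/
def PiA (w : ℝ → ℝ) (ℓ : ℕ) : ℝ := ∫ t in (ℓ : ℝ)..((ℓ : ℝ) + 1), w t

/-- the data of "the" strongly stable Cauchy–Born solution for the force `f`:
`w = ∇u^cb`, `w1 = ∇²u^cb`, `w2 = ∇³u^cb`, with constant `Cw` -/
def CBSolution (V : ℝ → ℝ → ℝ) (f : ℕ → ℝ) (Cw : ℝ) (w w1 w2 : ℝ → ℝ) : Prop :=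
  MemLp w 2 (volume.restrict (Set.Ioi 0)) ∧
  (∀ᵐ x ∂(volume.restrict (Set.Ioi (0 : ℝ))), dW V (w x) = gTilde f x) ∧
  (∃ ccb : ℝ, 0 < ccb ∧ ∀ vw : ℝ → ℝ, MemLp vw 2 (volume.restrict (Set.Ioi 0)) →
    ccb * ∫ x in Set.Ioi (0 : ℝ), (vw x) ^ 2 ≤
      ∫ x in Set.Ioi (0 : ℝ), d2W V (w x) * (vw x) ^ 2) ∧
  (∀ x ∈ Set.Ici (0 : ℝ), HasDerivAt w (w1 x) x) ∧
  (∀ᵐ x ∂(volume.restrict (Set.Ioi (0 : ℝ))), HasDerivAt w1 (w2 x) x) ∧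
  |w 0| ≤ Cw * dualNorm f


section SecondDerivative

variable {E : Type*} [NormedAddCommGroup E] [NormedSpace ℝ E]

/-- The second Fréchet derivative of a function on a normed space. -/
def hess (f : E → ℝ) (x : E) : E →L[ℝ] E →L[ℝ] ℝ := fderiv ℝ (fderiv ℝ f) x

lemma hasFDerivAt_fderiv {f : E → ℝ} (hf : ContDiff ℝ 3 f) (x : E) :
    HasFDerivAt (fderiv ℝ f) (hess f x) x :=
  ((hf.fderiv_right (m := 2) (by norm_num)).differentiable (by norm_num) x).hasFDerivAt

lemma hasDerivAt_fderiv_comp {f : E → ℝ} (hf : ContDiff ℝ 3 f) (w : E) {γ : ℝ → E} {γ' : E}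
    {t : ℝ} (hγ : HasDerivAt γ γ' t) :
    HasDerivAt (fun τ => fderiv ℝ f (γ τ) w) (hess f (γ t) γ' w) t := by
  simpa using ((hasFDerivAt_fderiv hf (γ t)).comp_hasDerivAt t hγ).clm_apply
    (hasDerivAt_const t w)

lemma norm_hess_le {f : E → ℝ} {B : ℝ} (hB : ∀ x, ‖iteratedFDeriv ℝ 2 f x‖ ≤ B) (x : E) :
    ‖hess f x‖ ≤ B := by
  have := hB x
  rwa [← norm_iteratedFDeriv_fderiv, norm_iteratedFDeriv_one] at this

lemma norm_hess_sub_le {f : E → ℝ} (hf : ContDiff ℝ 3 f) {B : ℝ}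
    (hB : ∀ x, ‖iteratedFDeriv ℝ 3 f x‖ ≤ B) (x y : E) :
    ‖hess f x - hess f y‖ ≤ B * ‖x - y‖ := by
  have hd : ContDiff ℝ 1 (fderiv ℝ (fderiv ℝ f)) :=
    (hf.fderiv_right (m := 2) (by norm_num)).fderiv_right (by norm_num)
  refine convex_univ.norm_image_sub_le_of_norm_fderiv_le (𝕜 := ℝ)
    (fun z _ => hd.differentiable (by norm_num) z) (fun z _ => ?_)
    (Set.mem_univ y) (Set.mem_univ x)
  have := hB z
  rwa [← norm_iteratedFDeriv_fderiv, ← norm_iteratedFDeriv_fderiv, norm_iteratedFDeriv_one]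
    at this

lemma norm_fderiv_sub_le {f : E → ℝ} (hf : ContDiff ℝ 3 f) {B : ℝ}
    (hB : ∀ x, ‖hess f x‖ ≤ B) (x y : E) :
    ‖fderiv ℝ f x - fderiv ℝ f y‖ ≤ B * ‖x - y‖ :=
  convex_univ.norm_image_sub_le_of_norm_hasFDerivWithin_le
    (fun z _ => (hasFDerivAt_fderiv hf z).hasFDerivWithinAt) (fun z _ => hB z)
    (Set.mem_univ y) (Set.mem_univ x)

lemma norm_fderiv_sub_sub_hess_le {f : E → ℝ} (hf : ContDiff ℝ 3 f) {B : ℝ} (hB0 : 0 ≤ B)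
    (hB : ∀ x y, ‖hess f x - hess f y‖ ≤ B * ‖x - y‖) {η : ℝ} {x y z : E}
    (hx : ‖x - z‖ ≤ η) (hy : ‖y - z‖ ≤ η) :
    ‖fderiv ℝ f x - fderiv ℝ f y - hess f z (x - y)‖ ≤ B * η * ‖x - y‖ := by
  refine (convex_closedBall z η).norm_image_sub_le_of_norm_hasFDerivWithin_le'
    (fun w _ => (hasFDerivAt_fderiv hf w).hasFDerivWithinAt) (fun w hw => ?_)
    (mem_closedBall_iff_norm.2 hy) (mem_closedBall_iff_norm.2 hx)
  exact (hB w z).trans (mul_le_mul_of_nonneg_left (mem_closedBall_iff_norm.1 hw) hB0)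

lemma norm_fderiv_translate_sub_le {f : E → ℝ} (hf : ContDiff ℝ 3 f) {B : ℝ}
    (hB : ∀ x y, ‖hess f x - hess f y‖ ≤ B * ‖x - y‖) (x y h : E) :
    ‖fderiv ℝ f (x + h) - fderiv ℝ f x - (fderiv ℝ f (y + h) - fderiv ℝ f y)‖ ≤
      B * ‖h‖ * ‖x - y‖ := by
  refine convex_univ.norm_image_sub_le_of_norm_hasFDerivWithin_le (𝕜 := ℝ)
    (f := fun z => fderiv ℝ f (z + h) - fderiv ℝ f z)
    (f' := fun z => hess f (z + h) - hess f z) (fun z _ => ?_) (fun z _ => ?_)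
    (Set.mem_univ y) (Set.mem_univ x)
  · exact (((hasFDerivAt_fderiv hf (z + h)).comp z ((hasFDerivAt_id z).add_const h)).sub
      (hasFDerivAt_fderiv hf z)).hasFDerivWithinAt
  · simpa using hB (z + h) z

end SecondDerivative

/-- The quadratic form of the Hessian of the site potential. -/
def quadV (V : ℝ → ℝ → ℝ) (r s x y : ℝ) : ℝ :=
  d11V V r s * x ^ 2 + 2 * d12V V r s * x * y + d22V V r s * y ^ 2

lemma hasDerivAt_prodMk_left (r s : ℝ) : HasDerivAt (fun t : ℝ => (t, s)) ((1 : ℝ), (0 : ℝ)) r :=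
  (hasDerivAt_id r).prodMk (hasDerivAt_const r s)

lemma hasDerivAt_prodMk_right (r s : ℝ) : HasDerivAt (fun t : ℝ => (r, t)) ((0 : ℝ), (1 : ℝ)) s :=
  (hasDerivAt_const s r).prodMk (hasDerivAt_id s)

section Partials

variable {V : ℝ → ℝ → ℝ} (hV : ContDiff ℝ 3 (Function.uncurry V))
include hV

lemma hasFDerivAt_uncurry (p : ℝ × ℝ) :
    HasFDerivAt (Function.uncurry V) (fderiv ℝ (Function.uncurry V) p) p :=
  (hV.differentiable (by norm_num) p).hasFDerivAt

lemma hasDerivAt_uncurry_comp {γ : ℝ → ℝ × ℝ} {γ' : ℝ × ℝ} {t : ℝ} (hγ : HasDerivAt γ γ' t) :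
    HasDerivAt (fun τ => V (γ τ).1 (γ τ).2) (fderiv ℝ (Function.uncurry V) (γ t) γ') t :=
  (hasFDerivAt_uncurry hV (γ t)).comp_hasDerivAt t hγ

lemma d1V_eq (r s : ℝ) : d1V V r s = fderiv ℝ (Function.uncurry V) (r, s) (1, 0) :=
  (hasDerivAt_uncurry_comp hV (hasDerivAt_prodMk_left r s)).deriv

lemma d2V_eq (r s : ℝ) : d2V V r s = fderiv ℝ (Function.uncurry V) (r, s) (0, 1) :=
  (hasDerivAt_uncurry_comp hV (hasDerivAt_prodMk_right r s)).deriv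

lemma d11V_eq (r s : ℝ) : d11V V r s = hess (Function.uncurry V) (r, s) (1, 0) (1, 0) := by
  simp only [d11V, d1V_eq hV]
  exact (hasDerivAt_fderiv_comp hV _ (hasDerivAt_prodMk_left r s)).deriv

lemma d12V_eq (r s : ℝ) : d12V V r s = hess (Function.uncurry V) (r, s) (0, 1) (1, 0) := by
  simp only [d12V, d1V_eq hV]
  exact (hasDerivAt_fderiv_comp hV _ (hasDerivAt_prodMk_right r s)).deriv

lemma d22V_eq (r s : ℝ) : d22V V r s = hess (Function.uncurry V) (r, s) (0, 1) (0, 1) := by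
  simp only [d22V, d2V_eq hV]
  exact (hasDerivAt_fderiv_comp hV _ (hasDerivAt_prodMk_right r s)).deriv

lemma fderiv_uncurry_apply (r s x y : ℝ) :
    fderiv ℝ (Function.uncurry V) (r, s) (x, y) = d1V V r s * x + d2V V r s * y := by
  have : ((x, y) : ℝ × ℝ) = x • (1, 0) + y • (0, 1) := by simp
  rw [this, map_add, map_smul, map_smul, d1V_eq hV, d2V_eq hV, smul_eq_mul, smul_eq_mul]
  ring

lemma hess_uncurry_apply (r s x y : ℝ) :
    hess (Function.uncurry V) (r, s) (x, y) (x, y) = quadV V r s x y := by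
  have hsymm : hess (Function.uncurry V) (r, s) (1, 0) (0, 1) =
      hess (Function.uncurry V) (r, s) (0, 1) (1, 0) :=
    (hV.contDiffAt.isSymmSndFDerivAt (by simp; norm_num)) (1, 0) (0, 1)
  have : ((x, y) : ℝ × ℝ) = x • (1, 0) + y • (0, 1) := by simp
  rw [this]
  simp only [map_add, map_smul, add_apply, smul_apply,
    smul_eq_mul, hsymm, quadV, d11V_eq hV, d12V_eq hV, d22V_eq hV]
  ring

lemma hasDerivAt_line (r s x y : ℝ) :
    HasDerivAt (fun t : ℝ => V (r + t * x) (s + t * y)) (d1V V r s * x + d2V V r s * y) 0 := by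
  have hl : HasDerivAt (fun t : ℝ => (r + t * x, s + t * y)) (x, y) 0 := by
    simpa using (((hasDerivAt_id (0 : ℝ)).mul_const x).const_add r).prodMk
      (((hasDerivAt_id (0 : ℝ)).mul_const y).const_add s)
  have := hasDerivAt_uncurry_comp hV hl
  simpa only [zero_mul, add_zero, fderiv_uncurry_apply hV] using this

lemma dW_eq (F : ℝ) : dW V F = d1V V F F + d2V V F F := by
  have hl : HasDerivAt (fun t : ℝ => (t, t)) ((1 : ℝ), (1 : ℝ)) F :=
    (hasDerivAt_id F).prodMk (hasDerivAt_id F)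
  have := (hasDerivAt_uncurry_comp hV hl).deriv
  rw [fderiv_uncurry_apply hV, mul_one, mul_one] at this
  exact this

end Partials

/-- Uniform bounds on the derivatives of the site potentials, in the form in which they enter
the estimates for the corrector problem. -/
structure DerivBounds (V : ℝ → ℝ → ℝ) (Vs : ℝ → ℝ) (B : ℝ) : Prop where
  pos : 0 < B
  d1_lip : ∀ a b a' b', |d1V V a b - d1V V a' b'| ≤ B * (|a - a'| + |b - b'|)
  d2_lip : ∀ a b a' b', |d2V V a b - d2V V a' b'| ≤ B * (|a - a'| + |b - b'|)
  d1_translate : ∀ a b a' b' h, |d1V V (h + a) (h + b) - d1V V a b -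
    (d1V V (h + a') (h + b') - d1V V a' b')| ≤ B * |h| * (|a - a'| + |b - b'|)
  d2_translate : ∀ a b a' b' h, |d2V V (h + a) (h + b) - d2V V a b -
    (d2V V (h + a') (h + b') - d2V V a' b')| ≤ B * |h| * (|a - a'| + |b - b'|)
  grad_sub : ∀ a b a' b' r s η, |a - r| ≤ η → |b - s| ≤ η → |a' - r| ≤ η → |b' - s| ≤ η →
    |(d1V V a b - d1V V a' b') * (a - a') + (d2V V a b - d2V V a' b') * (b - b') -
      quadV V r s (a - a') (b - b')| ≤ B * η * ((a - a') ^ 2 + (b - b') ^ 2)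
  quad_le : ∀ r s x y, |quadV V r s x y| ≤ B * (x ^ 2 + y ^ 2)
  quad_lip : ∀ r s r' s' η x y, |r - r'| ≤ η → |s - s'| ≤ η →
    |quadV V r s x y - quadV V r' s' x y| ≤ B * η * (x ^ 2 + y ^ 2)
  surf_lip : ∀ a b, |deriv Vs a - deriv Vs b| ≤ B * |a - b|
  surf_grad_sub : ∀ a b r η, |a - r| ≤ η → |b - r| ≤ η →
    |(deriv Vs a - deriv Vs b) * (a - b) - deriv (deriv Vs) r * (a - b) ^ 2| ≤
      B * η * (a - b) ^ 2
  surf_second_lip : ∀ a b, |deriv (deriv Vs) a - deriv (deriv Vs) b| ≤ B * |a - b|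

lemma norm_prodMk_le_add (x y : ℝ) : ‖((x, y) : ℝ × ℝ)‖ ≤ |x| + |y| := by
  simp [Prod.norm_def]

lemma norm_prodMk_sq_le (x y : ℝ) : ‖((x, y) : ℝ × ℝ)‖ ^ 2 ≤ x ^ 2 + y ^ 2 := by
  rw [Prod.norm_def]
  rcases max_choice ‖x‖ ‖y‖ with h | h <;> rw [h, Real.norm_eq_abs, sq_abs] <;>
    nlinarith [sq_nonneg x, sq_nonneg y]

lemma abs_clm_apply_apply_le {L : ℝ × ℝ →L[ℝ] ℝ × ℝ →L[ℝ] ℝ} {M : ℝ} (hL : ‖L‖ ≤ M) (x y : ℝ) :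
    |L (x, y) (x, y)| ≤ M * (x ^ 2 + y ^ 2) := by
  have h1 := L.le_opNorm₂ (x, y) (x, y)
  have h2 := norm_prodMk_sq_le x y
  have h3 : 0 ≤ ‖L‖ := norm_nonneg L
  rw [Real.norm_eq_abs] at h1
  calc |L (x, y) (x, y)| ≤ ‖L‖ * ‖((x, y) : ℝ × ℝ)‖ ^ 2 := by rw [sq, ← mul_assoc]; exact h1
    _ ≤ M * (x ^ 2 + y ^ 2) := mul_le_mul hL h2 (sq_nonneg _) (h3.trans hL)

lemma abs_clm_apply_unit_le {L : ℝ × ℝ →L[ℝ] ℝ} {M : ℝ} (hL : ‖L‖ ≤ M) {e : ℝ × ℝ}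
    (he : ‖e‖ ≤ 1) : |L e| ≤ M :=
  (L.le_opNorm_of_le he).trans (by rwa [mul_one])

lemma fderiv_apply_eq_deriv_mul (f : ℝ → ℝ) (x y : ℝ) : fderiv ℝ f x y = deriv f x * y := by
  simp [mul_comm]

lemma hess_apply_eq_deriv_mul {f : ℝ → ℝ} (hf : ContDiff ℝ 3 f) (x y z : ℝ) :
    hess f x y z = deriv (deriv f) x * y * z := by
  have h1 : HasDerivAt (deriv f) (hess f x 1 1) x := by
    have := ((hasFDerivAt_fderiv hf x).hasDerivAt).clm_apply (hasDerivAt_const x (1 : ℝ))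
    simpa using this
  rw [h1.deriv]
  have : hess f x (y • 1) (z • 1) = hess f x 1 1 * y * z := by
    rw [map_smul, map_smul, smul_apply, smul_eq_mul, smul_eq_mul]
    ring
  simpa using this

lemma SiteAssumptions.exists_derivBounds {V : ℝ → ℝ → ℝ} {Vs : ℝ → ℝ}
    (h : SiteAssumptions V Vs) : ∃ B, DerivBounds V Vs B := by
  obtain ⟨B1, hB1⟩ := h.bdd_V 2 (by norm_num)
  obtain ⟨B2, hB2⟩ := h.bdd_V 3 (by norm_num)
  obtain ⟨B3, hB3⟩ := h.bdd_Vs 2 (by norm_num)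
  obtain ⟨B4, hB4⟩ := h.bdd_Vs 3 (by norm_num)
  have hV := h.smooth_V
  have hVs := h.smooth_Vs
  obtain ⟨B, hB0, hBV, hBV', hBs, hBs'⟩ : ∃ B : ℝ, 0 < B ∧
      (∀ p, ‖hess (Function.uncurry V) p‖ ≤ B) ∧
      (∀ p p', ‖hess (Function.uncurry V) p - hess (Function.uncurry V) p'‖ ≤ B * ‖p - p'‖) ∧
      (∀ x, ‖hess Vs x‖ ≤ B) ∧ (∀ x y, ‖hess Vs x - hess Vs y‖ ≤ B * ‖x - y‖) := by
    have e1 : B1 ≤ 1 + |B1| + |B2| + |B3| + |B4| := by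
      linarith [le_abs_self B1, abs_nonneg B2, abs_nonneg B3, abs_nonneg B4]
    have e2 : B2 ≤ 1 + |B1| + |B2| + |B3| + |B4| := by
      linarith [abs_nonneg B1, le_abs_self B2, abs_nonneg B3, abs_nonneg B4]
    have e3 : B3 ≤ 1 + |B1| + |B2| + |B3| + |B4| := by
      linarith [abs_nonneg B1, abs_nonneg B2, le_abs_self B3, abs_nonneg B4]
    have e4 : B4 ≤ 1 + |B1| + |B2| + |B3| + |B4| := by
      linarith [abs_nonneg B1, abs_nonneg B2, abs_nonneg B3, le_abs_self B4]
    exact ⟨1 + |B1| + |B2| + |B3| + |B4|, by positivity,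
      norm_hess_le fun p => (hB1 p).trans e1, norm_hess_sub_le hV fun p => (hB2 p).trans e2,
      norm_hess_le fun p => (hB3 p).trans e3, norm_hess_sub_le hVs fun p => (hB4 p).trans e4⟩
  have he1 : ‖((1, 0) : ℝ × ℝ)‖ ≤ 1 := by simp [Prod.norm_def]
  have he2 : ‖((0, 1) : ℝ × ℝ)‖ ≤ 1 := by simp [Prod.norm_def]
  have lip (a b a' b' : ℝ) : ‖fderiv ℝ (Function.uncurry V) (a, b) -
      fderiv ℝ (Function.uncurry V) (a', b')‖ ≤ B * (|a - a'| + |b - b'|) :=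
    (norm_fderiv_sub_le hV hBV _ _).trans
      (mul_le_mul_of_nonneg_left (norm_prodMk_le_add _ _) hB0.le)
  have trans (a b a' b' h : ℝ) : ‖fderiv ℝ (Function.uncurry V) (h + a, h + b) -
      fderiv ℝ (Function.uncurry V) (a, b) - (fderiv ℝ (Function.uncurry V) (h + a', h + b') -
      fderiv ℝ (Function.uncurry V) (a', b'))‖ ≤ B * |h| * (|a - a'| + |b - b'|) := by
    have := norm_fderiv_translate_sub_le hV hBV' (a, b) (a', b') (h, h)
    simp only [Prod.mk_add_mk, Prod.mk_sub_mk, add_comm _ h] at this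
    refine this.trans ?_
    have hh : ‖((h, h) : ℝ × ℝ)‖ = |h| := by simp [Prod.norm_def]
    rw [hh]
    exact mul_le_mul_of_nonneg_left (norm_prodMk_le_add _ _) (by positivity)
  refine ⟨B, hB0, fun a b a' b' => ?_, fun a b a' b' => ?_, fun a b a' b' h => ?_,
    fun a b a' b' h => ?_, fun a b a' b' r s η h1 h2 h3 h4 => ?_, fun r s x y => ?_,
    fun r s r' s' η x y h1 h2 => ?_, fun a b => ?_, fun a b r η h1 h2 => ?_, fun a b => ?_⟩
  · simpa [d1V_eq hV] using abs_clm_apply_unit_le (lip a b a' b') he1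
  · simpa [d2V_eq hV] using abs_clm_apply_unit_le (lip a b a' b') he2
  · simpa [d1V_eq hV] using abs_clm_apply_unit_le (trans a b a' b' h) he1
  · simpa [d2V_eq hV] using abs_clm_apply_unit_le (trans a b a' b' h) he2
  · have key := norm_fderiv_sub_sub_hess_le hV hB0.le hBV' (η := η) (x := (a, b)) (y := (a', b'))
      (z := (r, s)) (by simpa [Prod.norm_def] using ⟨h1, h2⟩)
      (by simpa [Prod.norm_def] using ⟨h3, h4⟩)
    have hη : 0 ≤ η := (abs_nonneg _).trans h1
    have := (fderiv ℝ (Function.uncurry V) (a, b) - fderiv ℝ (Function.uncurry V) (a', b') -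
      hess (Function.uncurry V) (r, s) (a - a', b - b')).le_of_opNorm_le key (a - a', b - b')
    rw [sub_apply, sub_apply, fderiv_uncurry_apply hV,
      fderiv_uncurry_apply hV, hess_uncurry_apply hV, Real.norm_eq_abs, mul_assoc, Prod.mk_sub_mk,
      ← sq] at this
    refine le_trans (le_of_eq ?_) (this.trans
      (mul_le_mul_of_nonneg_left (norm_prodMk_sq_le _ _) (by positivity)))
    congr 1
    ring
  · rw [← hess_uncurry_apply hV]
    exact abs_clm_apply_apply_le (hBV _) x y
  · rw [← hess_uncurry_apply hV, ← hess_uncurry_apply hV]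
    refine abs_clm_apply_apply_le ((hBV' _ _).trans (mul_le_mul_of_nonneg_left ?_ hB0.le)) x y
    simpa [Prod.norm_def] using ⟨h1, h2⟩
  · have := (fderiv ℝ Vs a - fderiv ℝ Vs b).le_of_opNorm_le (norm_fderiv_sub_le hVs hBs a b) 1
    simpa [fderiv_apply_eq_deriv_mul] using this
  · have key := norm_fderiv_sub_sub_hess_le hVs hB0.le hBs' h1 h2
    have := (fderiv ℝ Vs a - fderiv ℝ Vs b - hess Vs r (a - b)).le_of_opNorm_le key (a - b)
    rw [sub_apply, sub_apply,
      hess_apply_eq_deriv_mul hVs, fderiv_apply_eq_deriv_mul, fderiv_apply_eq_deriv_mul,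
      mul_assoc (B * η), ← sq, Real.norm_eq_abs, Real.norm_eq_abs, sq_abs] at this
    refine le_trans (le_of_eq ?_) this
    congr 1
    ring
  · have := (hess Vs a - hess Vs b).le_of_opNorm₂_le_of_le (hBs' a b)
      (norm_one (α := ℝ)).le (norm_one (α := ℝ)).le
    simpa [hess_apply_eq_deriv_mul hVs] using this

lemma exists_memU_du_eq {δ : ℕ → ℝ} (hδ : Summable fun ℓ => δ ℓ ^ 2) :
    ∃ v, memU v ∧ du v = δ := by
  have hdu : du (fun n => ∑ i ∈ Finset.range n, δ i) = δ := by
    funext ℓ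
    simp [du, Finset.sum_range_succ]
  exact ⟨fun n => ∑ i ∈ Finset.range n, δ i, ⟨by simp, by rwa [hdu]⟩, hdu⟩

namespace SiteAssumptions

variable {V : ℝ → ℝ → ℝ} {Vs : ℝ → ℝ} (h : SiteAssumptions V Vs)
include h

lemma V_nonneg (r s : ℝ) : 0 ≤ V r s := by
  by_cases h0 : r = 0 ∧ s = 0
  · rw [h0.1, h0.2, h.V_zero]
  · have hpos : 0 < Real.sqrt (r ^ 2 + s ^ 2) := by
      refine Real.sqrt_pos.2 ?_
      by_contra! hle
      exact h0 ⟨by nlinarith [sq_nonneg r, sq_nonneg s], by nlinarith [sq_nonneg r, sq_nonneg s]⟩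
    obtain ⟨δ, hδ, hV⟩ := h.pos_away _ (half_pos hpos)
    exact hδ.le.trans (hV r s (half_lt_self hpos))

lemma Vs_nonneg (s : ℝ) : 0 ≤ Vs s :=
  ge_of_tendsto' (h.surf_limit s) fun r => h.V_nonneg r s

lemma dW_zero : dW V 0 = 0 := by
  refine IsLocalMin.deriv_eq_zero (Eventually.of_forall fun x => ?_)
  simpa [Wcb, h.V_zero] using h.V_nonneg x x

end SiteAssumptions

lemma EaE_eq_ofReal_add_tsum {V : ℝ → ℝ → ℝ} {Vs : ℝ → ℝ} (h : SiteAssumptions V Vs)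
    (u : ℕ → ℝ) (K : ℕ) :
    EaE V Vs u = ENNReal.ofReal
        (Vs (du u 0) + ∑ ℓ ∈ Finset.range K, V (du u ℓ) (du u (ℓ + 1))) +
      ∑' ℓ : ℕ, ENNReal.ofReal (V (du u (ℓ + K)) (du u (ℓ + K + 1))) := by
  rw [EaE, ENNReal.ofReal_add (h.Vs_nonneg _) (Finset.sum_nonneg fun _ _ => h.V_nonneg _ _),
    ENNReal.ofReal_sum_of_nonneg fun _ _ => h.V_nonneg _ _, add_assoc]
  congr 1
  exact (Summable.sum_add_tsum_nat_add' (k := K) ENNReal.summable).symm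

/-- A ground state is stationary under perturbations of finitely many strains. -/
lemma GroundState.finite_variation_eq_zero {V : ℝ → ℝ → ℝ} {Vs : ℝ → ℝ}
    (h : SiteAssumptions V Vs) {u : ℕ → ℝ} (hu : GroundState V Vs u) {η : ℕ → ℝ} {K : ℕ}
    (hη : ∀ ℓ, K ≤ ℓ → η ℓ = 0) :
    deriv Vs (du u 0) * η 0 + ∑ ℓ ∈ Finset.range K,
      (d1V V (du u ℓ) (du u (ℓ + 1)) * η ℓ + d2V V (du u ℓ) (du u (ℓ + 1)) * η (ℓ + 1)) = 0 := by
  let φ : ℝ → ℝ := fun t => Vs (du u 0 + t * η 0) +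
    ∑ ℓ ∈ Finset.range K, V (du u ℓ + t * η ℓ) (du u (ℓ + 1) + t * η (ℓ + 1))
  have hφ : HasDerivAt φ (deriv Vs (du u 0) * η 0 + ∑ ℓ ∈ Finset.range K,
      (d1V V (du u ℓ) (du u (ℓ + 1)) * η ℓ +
        d2V V (du u ℓ) (du u (ℓ + 1)) * η (ℓ + 1))) 0 := by
    refine HasDerivAt.add ?_ (HasDerivAt.fun_sum fun ℓ _ => hasDerivAt_line h.smooth_V _ _ _ _)
    have hl : HasDerivAt (fun t : ℝ => du u 0 + t * η 0) (η 0) 0 := by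
      simpa using ((hasDerivAt_id (0 : ℝ)).mul_const (η 0)).const_add (du u 0)
    refine HasDerivAt.comp (0 : ℝ) ?_ hl
    simpa using (h.smooth_Vs.differentiable (by norm_num) (du u 0)).hasDerivAt
  refine IsLocalMin.hasDerivAt_eq_zero (f := φ) (Eventually.of_forall fun t => ?_) hφ
  have hsum : Summable fun ℓ => (du u ℓ + t * η ℓ) ^ 2 :=
    (summable_nat_add_iff K).1 (((summable_nat_add_iff K).2 hu.1.2).congr fun ℓ => by
      simp [hη (ℓ + K) (Nat.le_add_left K ℓ)])
  obtain ⟨w, hw, hdw⟩ := exists_memU_du_eq hsum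
  obtain ⟨z, hz, hdz⟩ := exists_memU_du_eq (δ := 0) (by simp)
  have hfin : EaE V Vs u ≠ ⊤ := by
    refine ne_top_of_le_ne_top ?_ (hu.2 z hz)
    simp [EaE, hdz, h.V_zero]
  have hle := hu.2 w hw
  rw [EaE_eq_ofReal_add_tsum h u K] at hle hfin
  rw [EaE_eq_ofReal_add_tsum h w K, hdw] at hle
  have htail (ℓ : ℕ) : ENNReal.ofReal (V (du u (ℓ + K) + t * η (ℓ + K))
      (du u (ℓ + K + 1) + t * η (ℓ + K + 1))) =
        ENNReal.ofReal (V (du u (ℓ + K)) (du u (ℓ + K + 1))) := by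
    simp [hη (ℓ + K) (by omega), hη (ℓ + K + 1) (by omega)]
  simp only [htail] at hle
  have hle' := (ENNReal.add_le_add_iff_right fun htop => hfin (by rw [htop, add_top])).1 hle
  have := (ENNReal.ofReal_le_ofReal_iff
    (add_nonneg (h.Vs_nonneg _) (Finset.sum_nonneg fun _ _ => h.V_nonneg _ _))).1 hle'
  simpa [φ] using this

lemma GroundState.criticalA {V : ℝ → ℝ → ℝ} {Vs : ℝ → ℝ} (h : SiteAssumptions V Vs)
    {u : ℕ → ℝ} (hu : GroundState V Vs u) : CriticalA V Vs u := by
  have key (k : ℕ) := hu.finite_variation_eq_zero h (η := Pi.single k 1) (K := k + 1)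
    fun ℓ hℓ => Pi.single_eq_of_ne (by omega) _
  refine ⟨by simpa using key 0, fun j => ?_⟩
  have := key (j + 1)
  rw [Finset.sum_range_succ, Finset.sum_range_succ, Finset.sum_eq_zero fun ℓ hℓ => ?_] at this
  · simpa using this
  · have := Finset.mem_range.1 hℓ
    rw [Pi.single_eq_of_ne (by omega), Pi.single_eq_of_ne (by omega)]
    ring

/-- A Lipschitz, strongly monotone map on a ball of a Hilbert space has a zero in that ball
provided its value at the centre is small. -/
lemma exists_zero_of_strongly_monotone {H : Type*} [NormedAddCommGroup H]
    [InnerProductSpace ℝ H] [CompleteSpace H] {G : H → H} {e : H} {ρ α L : ℝ} (hρ : 0 < ρ)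
    (hα : 0 < α) (hαL : α ≤ L)
    (hmono : ∀ p ∈ Metric.closedBall e ρ, ∀ p' ∈ Metric.closedBall e ρ,
      α * ‖p - p'‖ ^ 2 ≤ inner ℝ (G p - G p') (p - p'))
    (hlip : ∀ p p', ‖G p - G p'‖ ≤ L * ‖p - p'‖)
    (hsmall : ‖G e‖ ≤ α * ρ / 2) :
    ∃ p ∈ Metric.closedBall e ρ, G p = 0 := by
  have hL : 0 < L := hα.trans_le hαL
  set τ : ℝ := α / L ^ 2 with hτ
  have hτ0 : 0 < τ := by positivity
  have hαL2 : α ^ 2 / L ^ 2 ≤ 1 := by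
    rw [div_le_one (by positivity)]
    gcongr
  have hratio : 0 < α ^ 2 / L ^ 2 := by positivity
  set k : ℝ := Real.sqrt (1 - α ^ 2 / L ^ 2) with hk
  have hk0 : 0 ≤ k := Real.sqrt_nonneg _
  have hk2 : k ^ 2 = 1 - α ^ 2 / L ^ 2 := Real.sq_sqrt (by linarith)
  have hk1 : k < 1 := by nlinarith
  have hkρ : α ^ 2 / L ^ 2 / 2 ≤ 1 - k := by nlinarith
  let T : H → H := fun p => p - τ • G p
  have hT : ∀ p ∈ Metric.closedBall e ρ, ∀ p' ∈ Metric.closedBall e ρ,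
      ‖T p - T p'‖ ≤ k * ‖p - p'‖ := by
    intro p hp p' hp'
    have h1 : T p - T p' = (p - p') - τ • (G p - G p') := by
      simp only [T, smul_sub]
      abel
    have h2 : ‖T p - T p'‖ ^ 2 ≤ (k * ‖p - p'‖) ^ 2 := by
      rw [h1, norm_sub_sq_real, real_inner_smul_right, norm_smul, Real.norm_eq_abs, mul_pow,
        sq_abs, mul_pow, hk2, real_inner_comm]
      have h3 := hmono p hp p' hp'
      have h4 : ‖G p - G p'‖ ^ 2 ≤ L ^ 2 * ‖p - p'‖ ^ 2 := by
        rw [← mul_pow]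
        exact pow_le_pow_left₀ (norm_nonneg _) (hlip p p') 2
      have h5 := mul_le_mul_of_nonneg_left h3 hτ0.le
      have h6 := mul_le_mul_of_nonneg_left h4 (sq_nonneg τ)
      have h7 : τ * α = α ^ 2 / L ^ 2 := by rw [hτ]; ring
      have h8 : τ ^ 2 * L ^ 2 = α ^ 2 / L ^ 2 := by rw [hτ]; field_simp
      rw [← mul_assoc, h7] at h5
      rw [← mul_assoc, h8] at h6
      linarith
    exact le_of_sq_le_sq h2 (by positivity)
  have hmaps : Set.MapsTo T (Metric.closedBall e ρ) (Metric.closedBall e ρ) := by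
    intro p hp
    have he := Metric.mem_closedBall_self (x := e) hρ.le
    have h1 := hT p hp e he
    rw [mem_closedBall_iff_norm] at hp ⊢
    have h2 : T p - e = (T p - T e) - τ • G e := by
      simp only [T]
      abel
    have h3 : ‖τ • G e‖ ≤ (1 - k) * ρ := by
      rw [norm_smul, Real.norm_eq_abs, abs_of_pos hτ0]
      calc τ * ‖G e‖ ≤ τ * (α * ρ / 2) := by gcongr
        _ = α ^ 2 / L ^ 2 / 2 * ρ := by rw [hτ]; ring
        _ ≤ (1 - k) * ρ := by gcongr
    calc ‖T p - e‖ ≤ ‖T p - T e‖ + ‖τ • G e‖ := by rw [h2]; exact norm_sub_le _ _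
      _ ≤ k * ρ + (1 - k) * ρ := add_le_add (h1.trans (by gcongr)) h3
      _ = ρ := by ring
  have hcontr : ContractingWith ⟨k, hk0⟩ (hmaps.restrict T _ _) := by
    refine ⟨by exact_mod_cast hk1, LipschitzWith.of_dist_le_mul fun p p' => ?_⟩
    rw [Subtype.dist_eq, Subtype.dist_eq, dist_eq_norm, dist_eq_norm]
    exact hT p p.2 p' p'.2
  obtain ⟨p, hp, hfix, -⟩ := hcontr.exists_fixedPoint' Metric.isClosed_closedBall.isComplete hmaps
    (Metric.mem_closedBall_self hρ.le) (edist_ne_top _ _)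
  refine ⟨p, hp, ?_⟩
  have h1 : p - τ • G p = p := hfix
  exact (smul_eq_zero.1 (sub_eq_self.1 h1)).resolve_left hτ0.ne'

section SquareSummable

variable {δ : ℕ → ℝ} (hδ : Summable fun ℓ => δ ℓ ^ 2)
include hδ

lemma summable_sq_succ : Summable fun ℓ => δ (ℓ + 1) ^ 2 :=
  (summable_nat_add_iff (f := fun ℓ => δ ℓ ^ 2) 1).2 hδ

lemma tsum_sq_eq_zero_add : ∑' ℓ, δ ℓ ^ 2 = δ 0 ^ 2 + ∑' ℓ, δ (ℓ + 1) ^ 2 :=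
  hδ.tsum_eq_zero_add

lemma summable_of_abs_le_sq_add_sq {f : ℕ → ℝ} {K : ℝ}
    (hf : ∀ ℓ, |f ℓ| ≤ K * (δ ℓ ^ 2 + δ (ℓ + 1) ^ 2)) : Summable f :=
  Summable.of_norm_bounded ((hδ.add (summable_sq_succ hδ)).mul_left K) hf

lemma summable_sq_and_tsum_sq_le {f : ℕ → ℝ} {M K : ℝ} (hK : 0 ≤ K)
    (h0 : f 0 ^ 2 ≤ M + K * (δ 0 ^ 2 + δ 1 ^ 2))
    (h1 : ∀ ℓ, f (ℓ + 1) ^ 2 ≤ K * (δ ℓ ^ 2 + δ (ℓ + 1) ^ 2 + δ (ℓ + 2) ^ 2)) :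
    (Summable fun ℓ => f ℓ ^ 2) ∧ ∑' ℓ, f ℓ ^ 2 ≤ M + 4 * K * ∑' ℓ, δ ℓ ^ 2 := by
  have hδ1 := summable_sq_succ hδ
  have hδ2 : Summable fun ℓ => δ (ℓ + 2) ^ 2 := summable_sq_succ (δ := fun ℓ => δ (ℓ + 1)) hδ1
  have hbd := ((hδ.add hδ1).add hδ2).mul_left K
  have hf1 : Summable fun ℓ => f (ℓ + 1) ^ 2 :=
    Summable.of_nonneg_of_le (fun _ => sq_nonneg _) h1 hbd
  have hf : Summable fun ℓ => f ℓ ^ 2 := (summable_nat_add_iff 1).1 hf1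
  refine ⟨hf, ?_⟩
  have hle := hf1.tsum_le_tsum h1 hbd
  rw [tsum_mul_left, (hδ.add hδ1).tsum_add hδ2, hδ.tsum_add hδ1] at hle
  have e0 := tsum_sq_eq_zero_add hδ
  have e1 : ∑' ℓ, δ (ℓ + 1) ^ 2 = δ 1 ^ 2 + ∑' ℓ, δ (ℓ + 2) ^ 2 :=
    tsum_sq_eq_zero_add (δ := fun ℓ => δ (ℓ + 1)) hδ1
  have hs : 0 ≤ ∑' ℓ, δ (ℓ + 2) ^ 2 := tsum_nonneg fun _ => sq_nonneg _
  rw [tsum_sq_eq_zero_add hf]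
  have key : K * (δ 0 ^ 2 + δ 1 ^ 2) + K * (∑' ℓ, δ ℓ ^ 2 + ∑' ℓ, δ (ℓ + 1) ^ 2 +
      ∑' ℓ, δ (ℓ + 2) ^ 2) ≤ 4 * K * ∑' ℓ, δ ℓ ^ 2 := by
    rw [← mul_add, mul_comm 4 K, mul_assoc]
    gcongr
    linarith [sq_nonneg (δ 0), sq_nonneg (δ 1)]
  linarith

end SquareSummable

lemma tsum_eq_add_tsum_of_summation_by_parts {a b r : ℕ → ℝ} {x : ℝ} (ha : Summable a)
    (hb : Summable b) (h0 : r 0 = x + a 0) (h1 : ∀ ℓ, r (ℓ + 1) = b ℓ + a (ℓ + 1)) :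
    ∑' ℓ, r ℓ = x + ∑' ℓ, (a ℓ + b ℓ) := by
  have ha1 : Summable fun ℓ => a (ℓ + 1) := (summable_nat_add_iff 1).2 ha
  have hr1 : Summable fun ℓ => r (ℓ + 1) := (hb.add ha1).congr fun ℓ => (h1 ℓ).symm
  rw [((summable_nat_add_iff 1).1 hr1).tsum_eq_zero_add, tsum_congr h1, hb.tsum_add ha1,
    ha.tsum_add hb, ha.tsum_eq_zero_add, h0]
  ring

/-- The residual of the Euler–Lagrange equations of the corrector problem, as a function of the
strains of the corrector. -/
def elResidual (V : ℝ → ℝ → ℝ) (Vs : ℝ → ℝ) (F : ℝ) (p : ℕ → ℝ) : ℕ → ℝ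
  | 0 => deriv Vs (F + p 0) + d1V V (F + p 0) (F + p 1) - dW V F
  | ℓ + 1 => d2V V (F + p ℓ) (F + p (ℓ + 1)) + d1V V (F + p (ℓ + 1)) (F + p (ℓ + 2)) - dW V F

/-- The second variation of the atomistic energy, as a function of the strains of the state and
of the test function. -/
def secondVar (V : ℝ → ℝ → ℝ) (Vs : ℝ → ℝ) (e δ : ℕ → ℝ) : ℝ :=
  deriv (deriv Vs) (e 0) * δ 0 ^ 2 + ∑' ℓ, quadV V (e ℓ) (e (ℓ + 1)) (δ ℓ) (δ (ℓ + 1))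

lemma criticalG_iff {V : ℝ → ℝ → ℝ} {Vs : ℝ → ℝ} {F : ℝ} {q : ℕ → ℝ} :
    CriticalG V Vs F q ↔ ∀ ℓ, elResidual V Vs F (du q) ℓ = 0 :=
  ⟨fun h ℓ => by cases ℓ with
    | zero => exact h.1
    | succ ℓ => exact h.2 ℓ, fun h => ⟨h 0, fun ℓ => h (ℓ + 1)⟩⟩

lemma add_add_sq_le (x y z : ℝ) : (x + 2 * y + z) ^ 2 ≤ 6 * (x ^ 2 + y ^ 2 + z ^ 2) := by
  nlinarith [sq_nonneg (2 * x - y), sq_nonneg (2 * z - y), sq_nonneg (x - z)]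

namespace DerivBounds

variable {V : ℝ → ℝ → ℝ} {Vs : ℝ → ℝ} {B : ℝ} (hB : DerivBounds V Vs B)
include hB

lemma residual_sub_sq_le_zero (F : ℝ) (p p' : ℕ → ℝ) :
    (elResidual V Vs F p 0 - elResidual V Vs F p' 0) ^ 2 ≤
      6 * B ^ 2 * ((p 0 - p' 0) ^ 2 + (p 1 - p' 1) ^ 2) := by
  have h1 := hB.surf_lip (F + p 0) (F + p' 0)
  have h2 := hB.d1_lip (F + p 0) (F + p 1) (F + p' 0) (F + p' 1)
  simp only [add_sub_add_left_eq_sub] at h1 h2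
  have h3 : |elResidual V Vs F p 0 - elResidual V Vs F p' 0| ≤
      B * (|p 1 - p' 1| + 2 * |p 0 - p' 0| + 0) := by
    calc
      _ = |deriv Vs (F + p 0) - deriv Vs (F + p' 0) +
          (d1V V (F + p 0) (F + p 1) - d1V V (F + p' 0) (F + p' 1))| := by
        simp only [elResidual]
        congr 1
        ring
      _ ≤ _ := (abs_add_le _ _).trans (by linarith)
  have h4 := pow_le_pow_left₀ (abs_nonneg _) h3 2
  rw [sq_abs, mul_pow] at h4
  have h5 := mul_le_mul_of_nonneg_left (add_add_sq_le |p 1 - p' 1| |p 0 - p' 0| 0) (sq_nonneg B)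
  rw [sq_abs, sq_abs] at h5
  linarith

lemma residual_sub_sq_le_succ (F : ℝ) (p p' : ℕ → ℝ) (ℓ : ℕ) :
    (elResidual V Vs F p (ℓ + 1) - elResidual V Vs F p' (ℓ + 1)) ^ 2 ≤
      6 * B ^ 2 * ((p ℓ - p' ℓ) ^ 2 + (p (ℓ + 1) - p' (ℓ + 1)) ^ 2 +
        (p (ℓ + 2) - p' (ℓ + 2)) ^ 2) := by
  have h1 := hB.d2_lip (F + p ℓ) (F + p (ℓ + 1)) (F + p' ℓ) (F + p' (ℓ + 1))
  have h2 := hB.d1_lip (F + p (ℓ + 1)) (F + p (ℓ + 2)) (F + p' (ℓ + 1)) (F + p' (ℓ + 2))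
  simp only [add_sub_add_left_eq_sub] at h1 h2
  have h3 : |elResidual V Vs F p (ℓ + 1) - elResidual V Vs F p' (ℓ + 1)| ≤
      B * (|p ℓ - p' ℓ| + 2 * |p (ℓ + 1) - p' (ℓ + 1)| + |p (ℓ + 2) - p' (ℓ + 2)|) := by
    calc
      _ = |d2V V (F + p ℓ) (F + p (ℓ + 1)) - d2V V (F + p' ℓ) (F + p' (ℓ + 1)) +
          (d1V V (F + p (ℓ + 1)) (F + p (ℓ + 2)) -
            d1V V (F + p' (ℓ + 1)) (F + p' (ℓ + 2)))| := by
        simp only [elResidual]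
        congr 1
        ring
      _ ≤ _ := (abs_add_le _ _).trans (by linarith)
  have h4 := pow_le_pow_left₀ (abs_nonneg _) h3 2
  rw [sq_abs, mul_pow] at h4
  have h5 := mul_le_mul_of_nonneg_left (add_add_sq_le |p ℓ - p' ℓ| |p (ℓ + 1) - p' (ℓ + 1)|
    |p (ℓ + 2) - p' (ℓ + 2)|) (sq_nonneg B)
  rw [sq_abs, sq_abs, sq_abs] at h5
  linarith

lemma tsum_residual_sub_sq_le (F : ℝ) {p p' : ℕ → ℝ}
    (hδ : Summable fun ℓ => (p ℓ - p' ℓ) ^ 2) :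
    ∑' ℓ, (elResidual V Vs F p ℓ - elResidual V Vs F p' ℓ) ^ 2 ≤
      24 * B ^ 2 * ∑' ℓ, (p ℓ - p' ℓ) ^ 2 := by
  have := (summable_sq_and_tsum_sq_le (f := elResidual V Vs F p - elResidual V Vs F p')
    (δ := p - p') hδ (M := 0) (K := 6 * B ^ 2) (by positivity)
    (by simpa using hB.residual_sub_sq_le_zero F p p') (hB.residual_sub_sq_le_succ F p p')).2
  simp only [Pi.sub_apply] at this
  linarith

lemma summable_residual_sq (hV : ContDiff ℝ 3 (Function.uncurry V)) (F : ℝ) {p : ℕ → ℝ}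
    (hp : Summable fun ℓ => p ℓ ^ 2) : Summable fun ℓ => elResidual V Vs F p ℓ ^ 2 := by
  refine (summable_sq_and_tsum_sq_le hp (M := elResidual V Vs F p 0 ^ 2) (K := 6 * B ^ 2)
    (by positivity) (le_add_of_nonneg_right (by positivity)) fun ℓ => ?_).1
  have h0 : elResidual V Vs F 0 (ℓ + 1) = 0 := by
    simp [elResidual, dW_eq hV, add_comm]
  simpa [h0] using hB.residual_sub_sq_le_succ F p 0 ℓ

lemma tsum_residual_sq_le (hV : ContDiff ℝ 3 (Function.uncurry V)) {F : ℝ} {e : ℕ → ℝ}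
    (he : Summable fun ℓ => e ℓ ^ 2) (h0 : ∀ ℓ, elResidual V Vs 0 e ℓ = 0) :
    ∑' ℓ, elResidual V Vs F e ℓ ^ 2 ≤ (B * F) ^ 2 * (49 + 24 * ∑' ℓ, e ℓ ^ 2) := by
  have := (summable_sq_and_tsum_sq_le (f := elResidual V Vs F e) he (M := 49 * (B * F) ^ 2)
    (K := 6 * (B * F) ^ 2) (by positivity) ?_ fun ℓ => ?_).2
  · linarith
  · have h1 := hB.surf_lip (F + e 0) (0 + e 0)
    have h2 := hB.d1_lip (F + e 0) (F + e 1) (0 + e 0) (0 + e 1)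
    have h3 := hB.d1_lip 0 0 F F
    have h4 := hB.d2_lip 0 0 F F
    simp only [add_sub_add_right_eq_sub, sub_zero, zero_sub, abs_neg] at h1 h2 h3 h4
    have h5 : |elResidual V Vs F e 0| ≤ 7 * (B * |F|) := by
      rw [← sub_zero (elResidual V Vs F e 0), ← h0 0]
      calc
      _ = |deriv Vs (F + e 0) - deriv Vs (0 + e 0) +
            (d1V V (F + e 0) (F + e 1) - d1V V (0 + e 0) (0 + e 1)) +
            (d1V V 0 0 - d1V V F F + (d2V V 0 0 - d2V V F F))| := by
          simp only [elResidual, dW_eq hV]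
          congr 1
          ring
        _ ≤ _ := (abs_add_le _ _).trans ((add_le_add (abs_add_le _ _) (abs_add_le _ _)).trans
          (by linarith))
    have h6 := pow_le_pow_left₀ (abs_nonneg _) h5 2
    rw [sq_abs, mul_pow, mul_pow B, sq_abs] at h6
    have h7 : 0 ≤ 6 * (B * F) ^ 2 * (e 0 ^ 2 + e 1 ^ 2) := by positivity
    linarith [mul_pow B F 2]
  · have h1 := hB.d2_translate (e ℓ) (e (ℓ + 1)) 0 0 F
    have h2 := hB.d1_translate (e (ℓ + 1)) (e (ℓ + 2)) 0 0 F
    simp only [add_zero, sub_zero] at h1 h2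
    have h3 : |elResidual V Vs F e (ℓ + 1)| ≤
        B * |F| * (|e ℓ| + 2 * |e (ℓ + 1)| + |e (ℓ + 2)|) := by
      rw [← sub_zero (elResidual V Vs F e (ℓ + 1)), ← h0 (ℓ + 1)]
      calc
      _ = |d2V V (F + e ℓ) (F + e (ℓ + 1)) - d2V V (e ℓ) (e (ℓ + 1)) -
              (d2V V F F - d2V V 0 0) +
            (d1V V (F + e (ℓ + 1)) (F + e (ℓ + 2)) - d1V V (e (ℓ + 1)) (e (ℓ + 2)) -
              (d1V V F F - d1V V 0 0))| := by
          simp only [elResidual, dW_eq hV, zero_add]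
          congr 1
          ring
        _ ≤ _ := (abs_add_le _ _).trans (by linarith)
    have h4 := pow_le_pow_left₀ (abs_nonneg _) h3 2
    rw [sq_abs, mul_pow, mul_pow B, sq_abs, ← mul_pow] at h4
    have h5 := mul_le_mul_of_nonneg_left (add_add_sq_le |e ℓ| |e (ℓ + 1)| |e (ℓ + 2)|)
      (sq_nonneg (B * F))
    rw [sq_abs, sq_abs, sq_abs] at h5
    linarith

lemma secondVar_sub_le {e δ s : ℕ → ℝ} {x η : ℝ} (hδ : Summable fun ℓ => δ ℓ ^ 2)
    (hx : |x - deriv (deriv Vs) (e 0) * δ 0 ^ 2| ≤ B * η * δ 0 ^ 2)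
    (hs : ∀ ℓ, |s ℓ - quadV V (e ℓ) (e (ℓ + 1)) (δ ℓ) (δ (ℓ + 1))| ≤
      B * η * (δ ℓ ^ 2 + δ (ℓ + 1) ^ 2)) :
    secondVar V Vs e δ - 2 * (B * η) * ∑' ℓ, δ ℓ ^ 2 ≤ x + ∑' ℓ, s ℓ := by
  have hq : Summable fun ℓ => quadV V (e ℓ) (e (ℓ + 1)) (δ ℓ) (δ (ℓ + 1)) :=
    summable_of_abs_le_sq_add_sq hδ fun ℓ => hB.quad_le _ _ _ _
  have hsq := summable_of_abs_le_sq_add_sq hδ hs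
  have hsum : Summable s := (hsq.add hq).congr fun ℓ => by ring
  have hδ1 := summable_sq_succ hδ
  have hle := hq.tsum_le_tsum (g := fun ℓ => s ℓ + B * η * (δ ℓ ^ 2 + δ (ℓ + 1) ^ 2))
    (fun ℓ => by linarith [(abs_le.1 (hs ℓ)).1]) (hsum.add ((hδ.add hδ1).mul_left _))
  rw [hsum.tsum_add ((hδ.add hδ1).mul_left _), tsum_mul_left, hδ.tsum_add hδ1] at hle
  have e0 := tsum_sq_eq_zero_add hδ
  have e1 : ∑' ℓ, δ (ℓ + 1) ^ 2 = ∑' ℓ, δ ℓ ^ 2 - δ 0 ^ 2 := by linarith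
  rw [e1] at hle
  rw [secondVar]
  linarith [(abs_le.1 hx).1]

lemma secondVar_perturb {e e' δ : ℕ → ℝ} {η : ℝ} (hδ : Summable fun ℓ => δ ℓ ^ 2)
    (he : ∀ ℓ, |e' ℓ - e ℓ| ≤ η) :
    secondVar V Vs e δ - 2 * (B * η) * ∑' ℓ, δ ℓ ^ 2 ≤ secondVar V Vs e' δ := by
  refine hB.secondVar_sub_le hδ ?_ fun ℓ => hB.quad_lip _ _ _ _ _ _ _ (he _) (he _)
  rw [← sub_mul, abs_mul, abs_of_nonneg (sq_nonneg (δ 0))]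
  have := (hB.surf_second_lip (e' 0) (e 0)).trans (mul_le_mul_of_nonneg_left (he 0) hB.pos.le)
  gcongr

lemma abs_mul_le_of_abs_le {x y z w : ℝ} (h : |z| ≤ B * (|x| + |y|)) (hw : |w| ≤ |x| + |y|) :
    |z * w| ≤ 2 * B * (x ^ 2 + y ^ 2) := by
  have hB0 := hB.pos.le
  rw [abs_mul]
  calc |z| * |w| ≤ B * (|x| + |y|) * (|x| + |y|) := by gcongr
    _ = B * (|x| + |y|) ^ 2 := by ring
    _ ≤ B * (2 * (|x| ^ 2 + |y| ^ 2)) := by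
      gcongr
      nlinarith [sq_nonneg (|x| - |y|)]
    _ = 2 * B * (x ^ 2 + y ^ 2) := by rw [sq_abs, sq_abs]; ring

lemma residual_monotone {F η : ℝ} {e p p' : ℕ → ℝ} (hδ : Summable fun ℓ => (p ℓ - p' ℓ) ^ 2)
    (hp : ∀ ℓ, |F + p ℓ - e ℓ| ≤ η) (hp' : ∀ ℓ, |F + p' ℓ - e ℓ| ≤ η) :
    secondVar V Vs e (p - p') - 2 * (B * η) * ∑' ℓ, (p ℓ - p' ℓ) ^ 2 ≤
      ∑' ℓ, (elResidual V Vs F p ℓ - elResidual V Vs F p' ℓ) * (p ℓ - p' ℓ) := by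
  have h1 (ℓ : ℕ) : |(d1V V (F + p ℓ) (F + p (ℓ + 1)) - d1V V (F + p' ℓ) (F + p' (ℓ + 1))) *
      (p ℓ - p' ℓ)| ≤ 2 * B * ((p ℓ - p' ℓ) ^ 2 + (p (ℓ + 1) - p' (ℓ + 1)) ^ 2) := by
    have hlip := hB.d1_lip (F + p ℓ) (F + p (ℓ + 1)) (F + p' ℓ) (F + p' (ℓ + 1))
    rw [add_sub_add_left_eq_sub, add_sub_add_left_eq_sub] at hlip
    exact hB.abs_mul_le_of_abs_le hlip (by linarith [abs_nonneg (p (ℓ + 1) - p' (ℓ + 1))])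
  have h2 (ℓ : ℕ) : |(d2V V (F + p ℓ) (F + p (ℓ + 1)) - d2V V (F + p' ℓ) (F + p' (ℓ + 1))) *
      (p (ℓ + 1) - p' (ℓ + 1))| ≤ 2 * B * ((p ℓ - p' ℓ) ^ 2 + (p (ℓ + 1) - p' (ℓ + 1)) ^ 2) := by
    have hlip := hB.d2_lip (F + p ℓ) (F + p (ℓ + 1)) (F + p' ℓ) (F + p' (ℓ + 1))
    rw [add_sub_add_left_eq_sub, add_sub_add_left_eq_sub] at hlip
    exact hB.abs_mul_le_of_abs_le hlip (by linarith [abs_nonneg (p ℓ - p' ℓ)])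
  rw [tsum_eq_add_tsum_of_summation_by_parts
    (r := fun ℓ => (elResidual V Vs F p ℓ - elResidual V Vs F p' ℓ) * (p ℓ - p' ℓ))
    (x := (deriv Vs (F + p 0) - deriv Vs (F + p' 0)) * (p 0 - p' 0))
    (summable_of_abs_le_sq_add_sq (δ := p - p') hδ h1)
    (summable_of_abs_le_sq_add_sq (δ := p - p') hδ h2)
    (by simp only [elResidual]; ring) (fun ℓ => by simp only [elResidual]; ring)]
  refine hB.secondVar_sub_le (δ := p - p') hδ ?_ fun ℓ => ?_
  · simpa using hB.surf_grad_sub (F + p 0) (F + p' 0) (e 0) η (hp 0) (hp' 0)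
  · simpa using hB.grad_sub (F + p ℓ) (F + p (ℓ + 1)) (F + p' ℓ) (F + p' (ℓ + 1)) (e ℓ)
      (e (ℓ + 1)) η (hp _) (hp _) (hp' _) (hp' _)

end DerivBounds

lemma exists_pos_le_quadratic_form {a b c : ℝ}
    (h : ∀ p : ℝ × ℝ, p ≠ 0 → 0 < a * p.1 ^ 2 + 2 * b * p.1 * p.2 + c * p.2 ^ 2) :
    ∃ m, 0 < m ∧ ∀ x y, m * (x ^ 2 + y ^ 2) ≤ a * x ^ 2 + 2 * b * x * y + c * y ^ 2 := by
  have ha : 0 < a := by simpa using h (1, 0) (by simp)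
  have hc : 0 < c := by simpa using h (0, 1) (by simp)
  have hdet : 0 < a * c - b ^ 2 := by
    have h1 := h (b, -a) (by simp [ha.ne'])
    have h2 : 0 < a * (a * c - b ^ 2) := by
      simp only at h1
      linarith
    exact pos_of_mul_pos_right h2 ha.le
  refine ⟨(a * c - b ^ 2) / (a + c), by positivity, fun x y => ?_⟩
  rw [div_mul_eq_mul_div, div_le_iff₀ (by positivity)]
  nlinarith [sq_nonneg (a * x + b * y), sq_nonneg (b * x + c * y)]

/-- A sequence of tails which contracts every two steps decays geometrically. -/
lemma exists_geometric_bound {S p : ℕ → ℝ} {θ : ℝ} {N : ℕ} (hθ0 : 0 < θ) (hθ1 : θ < 1)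
    (hS : Antitone S) (hp : ∀ ℓ, p ℓ ^ 2 ≤ S ℓ) (hstep : ∀ ℓ, N ≤ ℓ → S (ℓ + 2) ≤ θ * S ℓ) :
    ∃ C μ : ℝ, 0 < C ∧ 0 ≤ μ ∧ μ < 1 ∧ ∀ ℓ, |p ℓ| ≤ C * μ ^ ℓ := by
  have hS0 (ℓ : ℕ) : 0 ≤ S ℓ := (sq_nonneg _).trans (hp ℓ)
  set ν : ℝ := Real.sqrt θ with hν
  have hν0 : 0 < ν := Real.sqrt_pos.2 hθ0
  have hν2 : ν ^ 2 = θ := Real.sq_sqrt hθ0.le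
  have hν1 : ν < 1 := (Real.sqrt_lt' one_pos).2 (by simpa using hθ1)
  set D : ℝ := S 0 / ν ^ (N + 2) + 1 with hD
  have hD0 : 0 < D := add_pos_of_nonneg_of_pos (div_nonneg (hS0 0) (by positivity)) one_pos
  have hbound (ℓ : ℕ) : S ℓ ≤ D * ν ^ ℓ := by
    induction ℓ using Nat.strong_induction_on with
    | _ ℓ ih =>
      by_cases hℓ : ℓ < N + 2
      · calc S ℓ ≤ S 0 := hS (Nat.zero_le ℓ)
          _ = S 0 / ν ^ (N + 2) * ν ^ (N + 2) := by field_simp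
          _ ≤ D * ν ^ ℓ := mul_le_mul (by linarith)
              (pow_le_pow_of_le_one hν0.le hν1.le hℓ.le) (by positivity) hD0.le
      · obtain ⟨k, rfl⟩ : ∃ k, ℓ = k + 2 := ⟨ℓ - 2, by omega⟩
        calc S (k + 2) ≤ θ * S k := hstep k (by omega)
          _ ≤ θ * (D * ν ^ k) := by gcongr; exact ih k (by omega)
          _ = D * ν ^ (k + 2) := by rw [← hν2]; ring
  refine ⟨Real.sqrt D, Real.sqrt ν, Real.sqrt_pos.2 hD0, Real.sqrt_nonneg _,
    (Real.sqrt_lt' one_pos).2 (by simpa using hν1), fun ℓ => abs_le_of_sq_le_sq ?_ (by positivity)⟩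
  rw [mul_pow, Real.sq_sqrt hD0.le, ← pow_mul, mul_comm ℓ 2, pow_mul, Real.sq_sqrt hν0.le]
  exact (hp ℓ).trans (hbound ℓ)

/-- Square summable strains of a corrector decay exponentially when the bulk is stable. -/
lemma DerivBounds.exists_geometric_bound_of_elResidual_eq_zero {V : ℝ → ℝ → ℝ} {Vs : ℝ → ℝ}
    {B F m : ℝ} (hB : DerivBounds V Vs B) (hV : ContDiff ℝ 3 (Function.uncurry V)) (hm : 0 < m)
    (hquad : ∀ x y, m * (x ^ 2 + y ^ 2) ≤ quadV V 0 0 x y) (hF : |F| ≤ m / (4 * B))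
    {p : ℕ → ℝ} (hp : Summable fun ℓ => p ℓ ^ 2) (hres : ∀ ℓ, elResidual V Vs F p ℓ = 0) :
    ∃ C μ : ℝ, 0 < C ∧ 0 ≤ μ ∧ μ < 1 ∧ ∀ ℓ, |p ℓ| ≤ C * μ ^ ℓ := by
  have hB0 := hB.pos
  obtain ⟨N, hN⟩ : ∃ N, ∀ ℓ, N ≤ ℓ → |p ℓ| ≤ m / (4 * B) := by
    have h0 : Tendsto (fun ℓ => |p ℓ|) atTop (nhds 0) := by
      have := (Real.continuous_sqrt.tendsto 0).comp hp.tendsto_atTop_zero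
      simpa [Function.comp_def, Real.sqrt_sq_eq_abs] using this
    exact eventually_atTop.1 (h0.eventually_le_const (by positivity))
  let S : ℕ → ℝ := fun n => ∑' ℓ, p (ℓ + n) ^ 2
  have hsum (n : ℕ) : Summable fun ℓ => p (ℓ + n) ^ 2 :=
    (summable_nat_add_iff (f := fun ℓ => p ℓ ^ 2) n).2 hp
  have hSstep (n : ℕ) : S n = p n ^ 2 + S (n + 1) := by
    have := (hsum n).tsum_eq_zero_add
    simp only [zero_add, add_assoc, add_comm 1 n] at this
    exact this
  have hS0 (n : ℕ) : 0 ≤ S n := tsum_nonneg fun _ => sq_nonneg _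
  let a : ℕ → ℝ := fun ℓ => (d1V V (F + p ℓ) (F + p (ℓ + 1)) - d1V V F F) * p ℓ
  let b : ℕ → ℝ := fun ℓ => (d2V V (F + p ℓ) (F + p (ℓ + 1)) - d2V V F F) * p (ℓ + 1)
  have ha_le (ℓ : ℕ) : |a ℓ| ≤ 2 * B * (p ℓ ^ 2 + p (ℓ + 1) ^ 2) := by
    have hlip := hB.d1_lip (F + p ℓ) (F + p (ℓ + 1)) F F
    rw [add_sub_cancel_left, add_sub_cancel_left] at hlip
    exact hB.abs_mul_le_of_abs_le hlip (by linarith [abs_nonneg (p (ℓ + 1))])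
  have hb_le (ℓ : ℕ) : |b ℓ| ≤ 2 * B * (p ℓ ^ 2 + p (ℓ + 1) ^ 2) := by
    have hlip := hB.d2_lip (F + p ℓ) (F + p (ℓ + 1)) F F
    rw [add_sub_cancel_left, add_sub_cancel_left] at hlip
    exact hB.abs_mul_le_of_abs_le hlip (by linarith [abs_nonneg (p ℓ)])
  have ha : Summable a := summable_of_abs_le_sq_add_sq hp ha_le
  have hb : Summable b := summable_of_abs_le_sq_add_sq hp hb_le
  have heq (ℓ : ℕ) : b ℓ + a (ℓ + 1) = 0 := by
    have := hres (ℓ + 1)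
    simp only [elResidual, dW_eq hV] at this
    linear_combination p (ℓ + 1) * this
  have hcoer (ℓ : ℕ) (hℓ : N ≤ ℓ) : m / 2 * (p ℓ ^ 2 + p (ℓ + 1) ^ 2) ≤ a ℓ + b ℓ := by
    have habs (k : ℕ) (hk : N ≤ k) : |F + p k - 0| ≤ m / (2 * B) := by
      rw [sub_zero]
      calc |F + p k| ≤ |F| + |p k| := abs_add_le _ _
        _ ≤ m / (4 * B) + m / (4 * B) := add_le_add hF (hN k hk)
        _ = m / (2 * B) := by field_simp; norm_num
    have hF' : |F - 0| ≤ m / (2 * B) := by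
      rw [sub_zero]
      exact hF.trans (by gcongr; norm_num)
    have h1 := hB.grad_sub (F + p ℓ) (F + p (ℓ + 1)) F F 0 0 (m / (2 * B)) (habs ℓ hℓ)
      (habs (ℓ + 1) (by omega)) hF' hF'
    rw [add_sub_cancel_left, add_sub_cancel_left] at h1
    have h2 : B * (m / (2 * B)) = m / 2 := by field_simp
    rw [h2] at h1
    have h3 := hquad (p ℓ) (p (ℓ + 1))
    have h4 := (abs_le.1 h1).1
    simp only [a, b]
    linarith
  have hdecay (n : ℕ) (hn : N ≤ n) : m / 2 * S (n + 1) ≤ 2 * B * (p n ^ 2 + p (n + 1) ^ 2) := by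
    have hsa : Summable fun ℓ => a (ℓ + (n + 1)) := (summable_nat_add_iff (n + 1)).2 ha
    have hsb : Summable fun ℓ => b (ℓ + (n + 1)) := (summable_nat_add_iff (n + 1)).2 hb
    have hparts := tsum_eq_add_tsum_of_summation_by_parts (r := Pi.single 0 (a (n + 1))) (x := 0)
      hsa hsb (by simp) fun ℓ => by
        have := heq (ℓ + (n + 1))
        rw [show ℓ + 1 + (n + 1) = ℓ + (n + 1) + 1 by omega, this]
        simp
    rw [tsum_pi_single, zero_add] at hparts
    calc m / 2 * S (n + 1) = ∑' ℓ, m / 2 * p (ℓ + (n + 1)) ^ 2 := tsum_mul_left.symm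
      _ ≤ ∑' ℓ, (a (ℓ + (n + 1)) + b (ℓ + (n + 1))) := by
        refine ((hsum (n + 1)).mul_left _).tsum_le_tsum (fun ℓ => ?_) (hsa.add hsb)
        refine le_trans ?_ (hcoer (ℓ + (n + 1)) (by omega))
        gcongr
        exact le_add_of_nonneg_right (sq_nonneg _)
      _ = - b n := by linarith [heq n]
      _ ≤ _ := (neg_le_abs _).trans (hb_le n)
  refine exists_geometric_bound (S := S) (θ := 2 * B / (2 * B + m / 2)) (N := N) (by positivity)
    ((div_lt_one (by positivity)).2 (by linarith))
    (antitone_nat_of_succ_le fun n => by linarith [hSstep n, sq_nonneg (p n)])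
    (fun ℓ => by linarith [hSstep ℓ, hS0 (ℓ + 1)]) fun n hn => ?_
  rw [div_mul_eq_mul_div, le_div_iff₀ (by positivity)]
  have h1 := hdecay n hn
  have h2 := hSstep n
  have h3 := hSstep (n + 1)
  have h4 : p n ^ 2 + p (n + 1) ^ 2 = S n - S (n + 2) := by linarith
  rw [h4] at h1
  have h5 : m / 2 * S (n + 2) ≤ m / 2 * S (n + 1) := by
    gcongr
    linarith [sq_nonneg (p (n + 1))]
  linarith

lemma memℓp_two_iff_summable_sq {f : ℕ → ℝ} :
    Memℓp f 2 ↔ Summable fun ℓ => f ℓ ^ 2 := by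
  rw [memℓp_gen_iff (by norm_num)]
  simp

lemma lp_norm_sq_eq_tsum_sq (f : lp (fun _ : ℕ => ℝ) 2) : ‖f‖ ^ 2 = ∑' ℓ, f ℓ ^ 2 := by
  rw [← real_inner_self_eq_norm_sq, lp.inner_eq_tsum]
  exact tsum_congr fun ℓ => by simp

lemma summable_lp_sq (f : lp (fun _ : ℕ => ℝ) 2) : Summable fun ℓ => f ℓ ^ 2 :=
  memℓp_two_iff_summable_sq.1 (lp.memℓp f)

lemma DerivBounds.exists_elResidual_eq_zero {V : ℝ → ℝ → ℝ} {Vs : ℝ → ℝ} {B c F : ℝ}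
    (hB : DerivBounds V Vs B) (hV : ContDiff ℝ 3 (Function.uncurry V)) (hc : 0 < c) {e : ℕ → ℝ}
    (he : Summable fun ℓ => e ℓ ^ 2) (h0 : ∀ ℓ, elResidual V Vs 0 e ℓ = 0)
    (hstab : ∀ δ : ℕ → ℝ, (Summable fun ℓ => δ ℓ ^ 2) →
      c * ∑' ℓ, δ ℓ ^ 2 ≤ secondVar V Vs e δ)
    (hF : |F| ≤ c / (8 * B))
    (hF' : |F| ≤ c ^ 2 / (32 * B ^ 2 * Real.sqrt (49 + 24 * ∑' ℓ, e ℓ ^ 2))) :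
    ∃ p : ℕ → ℝ, (Summable fun ℓ => p ℓ ^ 2) ∧ (∀ ℓ, |F + p ℓ - e ℓ| ≤ c / (4 * B)) ∧
      ∀ ℓ, elResidual V Vs F p ℓ = 0 := by
  have hB0 := hB.pos
  have hmem (p : lp (fun _ : ℕ => ℝ) 2) : Memℓp (elResidual V Vs F p) 2 :=
    memℓp_two_iff_summable_sq.2 (hB.summable_residual_sq hV F (summable_lp_sq p))
  let G : lp (fun _ : ℕ => ℝ) 2 → lp (fun _ : ℕ => ℝ) 2 := fun p => ⟨_, hmem p⟩
  let e' : lp (fun _ : ℕ => ℝ) 2 := ⟨e, memℓp_two_iff_summable_sq.2 he⟩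
  have hclose : ∀ p ∈ Metric.closedBall e' (c / (8 * B)), ∀ ℓ,
      |F + p ℓ - e ℓ| ≤ c / (4 * B) := by
    intro p hp ℓ
    have h1 : |p ℓ - e ℓ| ≤ c / (8 * B) :=
      (lp.norm_apply_le_norm two_ne_zero (p - e') ℓ).trans (mem_closedBall_iff_norm.1 hp)
    calc |F + p ℓ - e ℓ| ≤ |F| + |p ℓ - e ℓ| := by rw [add_sub_assoc]; exact abs_add_le _ _
      _ ≤ c / (8 * B) + c / (8 * B) := add_le_add hF h1
      _ = c / (4 * B) := by field_simp; norm_num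
  have hsub (p p' : lp (fun _ : ℕ => ℝ) 2) : Summable fun ℓ => (p ℓ - p' ℓ) ^ 2 :=
    summable_lp_sq (p - p')
  have hnorm (p p' : lp (fun _ : ℕ => ℝ) 2) : ‖p - p'‖ ^ 2 = ∑' ℓ, (p ℓ - p' ℓ) ^ 2 :=
    lp_norm_sq_eq_tsum_sq (p - p')
  suffices hzero : ∃ p ∈ Metric.closedBall e' (c / (8 * B)), G p = 0 by
    obtain ⟨p, hp, hGp⟩ := hzero
    exact ⟨p, summable_lp_sq p, hclose p hp, fun ℓ => congrFun (congrArg Subtype.val hGp) ℓ⟩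
  refine exists_zero_of_strongly_monotone (α := c / 2) (L := max (5 * B) (c / 2)) (by positivity)
    (by positivity) (le_max_right _ _) (fun p hp p' hp' => ?_) (fun p p' => ?_) ?_
  · have h1 := hB.residual_monotone (hsub p p') (hclose p hp) (hclose p' hp')
    have h2 := hstab (p - p') (hsub p p')
    have h3 : 2 * (B * (c / (4 * B))) = c / 2 := by field_simp; norm_num
    have h4 : inner ℝ (G p - G p') (p - p') =
        ∑' ℓ, (elResidual V Vs F p ℓ - elResidual V Vs F p' ℓ) * (p ℓ - p' ℓ) := by
      rw [lp.inner_eq_tsum]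
      exact tsum_congr fun ℓ => mul_comm ((p - p') ℓ) ((G p - G p') ℓ)
    rw [h3] at h1
    rw [h4, hnorm]
    simp only [Pi.sub_apply] at h2
    linarith
  · have h1 : ‖G p - G p'‖ ^ 2 ≤ (5 * B * ‖p - p'‖) ^ 2 := by
      rw [hnorm, mul_pow, hnorm]
      refine (hB.tsum_residual_sub_sq_le F (hsub p p')).trans ?_
      have : 0 ≤ ∑' ℓ, (p ℓ - p' ℓ) ^ 2 := tsum_nonneg fun _ => sq_nonneg _
      gcongr
      nlinarith
    calc ‖G p - G p'‖ ≤ 5 * B * ‖p - p'‖ := le_of_sq_le_sq h1 (by positivity)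
      _ ≤ max (5 * B) (c / 2) * ‖p - p'‖ := by gcongr; exact le_max_left _ _
  · set S := 49 + 24 * ∑' ℓ, e ℓ ^ 2 with hS
    have hS0 : 0 < S := by
      have : 0 ≤ ∑' ℓ, e ℓ ^ 2 := tsum_nonneg fun _ => sq_nonneg _
      positivity
    have h1 : ‖G e'‖ ^ 2 ≤ (B * |F| * Real.sqrt S) ^ 2 := by
      rw [lp_norm_sq_eq_tsum_sq, mul_pow, Real.sq_sqrt hS0.le, mul_pow, sq_abs, ← mul_pow]
      exact hB.tsum_residual_sq_le hV he h0
    calc ‖G e'‖ ≤ B * |F| * Real.sqrt S := le_of_sq_le_sq h1 (by positivity)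
      _ ≤ B * (c ^ 2 / (32 * B ^ 2 * Real.sqrt S)) * Real.sqrt S := by gcongr
      _ = c / 2 * (c / (8 * B)) / 2 := by field_simp; norm_num

/-- existence, stability and exponential decay of the solution of
the infinite corrector problem for small `F₀`. -/
theorem existence_infinite_corrector (V : ℝ → ℝ → ℝ) (Vs : ℝ → ℝ)
    (h : SiteAssumptions V Vs) (ugr : ℕ → ℝ) (ca : ℝ)
    (hgs : StronglyStableGS V Vs ugr ca) :
    ∃ εΓ : ℝ, 0 < εΓ ∧ ∀ F0 : ℝ, |F0| < εΓ →
      ∃ q : ℕ → ℝ, memU q ∧ CriticalG V Vs F0 q ∧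
        (∀ v : ℕ → ℝ, memU v →
          ca / 2 * ∑' ℓ, (du v ℓ) ^ 2 ≤ svG V Vs F0 q v) ∧
        ∃ C μ : ℝ, 0 < C ∧ 0 ≤ μ ∧ μ < 1 ∧ ∀ ℓ : ℕ, |du q ℓ| ≤ C * μ ^ ℓ := by
  obtain ⟨B, hB⟩ := h.exists_derivBounds
  obtain ⟨hground, hca, hstab⟩ := hgs
  have hB0 := hB.pos
  have he : Summable fun ℓ => du ugr ℓ ^ 2 := hground.1.2
  have hcrit := hground.criticalA h
  have h0 : ∀ ℓ, elResidual V Vs 0 (du ugr) ℓ = 0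
    | 0 => by simpa [elResidual, h.dW_zero] using hcrit.1
    | ℓ + 1 => by simpa [elResidual, h.dW_zero] using hcrit.2 ℓ
  obtain ⟨m, hm, hquad⟩ := exists_pos_le_quadratic_form h.posdef
  have hS : 0 < Real.sqrt (49 + 24 * ∑' ℓ, du ugr ℓ ^ 2) := by
    have : 0 ≤ ∑' ℓ, du ugr ℓ ^ 2 := tsum_nonneg fun _ => sq_nonneg _
    positivity
  refine ⟨min (m / (4 * B)) (min (ca / (8 * B))
    (ca ^ 2 / (32 * B ^ 2 * Real.sqrt (49 + 24 * ∑' ℓ, du ugr ℓ ^ 2)))), by positivity,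
    fun F0 hF0 => ?_⟩
  obtain ⟨hF1, hF2, hF3⟩ : _ ∧ _ ∧ _ := by simpa only [lt_min_iff] using hF0
  obtain ⟨p, hp, hclose, hres⟩ := hB.exists_elResidual_eq_zero h.smooth_V hca he h0
    (fun δ hδ => by
      obtain ⟨v, hv, rfl⟩ := exists_memU_du_eq hδ
      exact hstab v hv) hF2.le hF3.le
  obtain ⟨q, hq, rfl⟩ := exists_memU_du_eq hp
  refine ⟨q, hq, criticalG_iff.2 hres, fun v hv => ?_,
    hB.exists_geometric_bound_of_elResidual_eq_zero h.smooth_V hm hquad hF1.le hp hres⟩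
  have h1 := hstab v hv
  have h2 : secondVar V Vs (du ugr) (du v) - 2 * (B * (ca / (4 * B))) * ∑' ℓ, du v ℓ ^ 2 ≤
      secondVar V Vs (fun ℓ => F0 + du q ℓ) (du v) := hB.secondVar_perturb hv.2 hclose
  have h3 : 2 * (B * (ca / (4 * B))) = ca / 2 := by field_simp; norm_num
  rw [h3] at h2
  change _ ≤ secondVar V Vs (du ugr) (du v) at h1
  change _ ≤ secondVar V Vs (fun ℓ => F0 + du q ℓ) (du v)
  linarith

end
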